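/- arXiv:1308.0801 — 5 statements merged into one kernel-verified Lean document; each statement's English description precedes it below -/
import Mathlib

section
/- For a finite filtration F of finite CW-complexes, for each r > 0 there is a long exact sequence ⋯ → H_n^{s,s+r−1}(F) → E^{(r)}_{n,s}(F) → H_{n−1}^{s−r,s−1}(F) → H_{n−1}^{s−r+1,s}(F) → ⋯ relating the r-th page of the homology spectral sequence of F to its persistent homology groups, and moreover the image of the map i^{(r)}_{n,s} appearing in it equals H_n^{s,s+r}(F). -/
set_option autoImplicit false

/-!
We model a finite filtration `∅ = X₀ ⊂ X₁ ⊂ ⋯ ⊂ X_N = X` of finite CW-complexes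
(homology with coefficients in a field `k`) by the algebraic data it induces:
* `H n s` plays the role of `H_n(X_s)` and `E1 n s` that of `H_n(X_s, X_{s-1})`;
* `f n s t : H n s →ₗ[k] H n t` is the map induced by inclusion (for `s ≤ t`);
* `p n s : H n s →ₗ[k] E1 n s` and `bd n s : E1 n s →ₗ[k] H (n-1) (s-1)` are the maps
  of the long exact homology sequences of the pairs `(X_s, X_{s-1})`.
The hypotheses `hf_id`, `hf_comp` (functoriality), `hzeroH`, `hzeroE` (`X_s = ∅` for
`s ≤ 0` and `X_s = X_N` for `s ≥ N`), `hstable`, and `hexact_p`, `hexact_bd`,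
`hexact_i` (exactness of the long exact sequences) appearing in the theorems below
express exactly these facts.
-/

universe u v

variable {k : Type u} [Field k] (N : ℕ)
variable {H : ℤ → ℤ → Type v} [∀ n s, AddCommGroup (H n s)] [∀ n s, Module k (H n s)]
  [∀ n s, FiniteDimensional k (H n s)]
variable {E1 : ℤ → ℤ → Type v} [∀ n s, AddCommGroup (E1 n s)] [∀ n s, Module k (E1 n s)]
  [∀ n s, FiniteDimensional k (E1 n s)]
variable (f : ∀ n s t : ℤ, H n s →ₗ[k] H n t)
variable (p : ∀ n s : ℤ, H n s →ₗ[k] E1 n s)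
variable (bd : ∀ n s : ℤ, E1 n s →ₗ[k] H (n - 1) (s - 1))

/-- The persistent homology group `H_n^{s,t}(F) = Im (H_n(X_s) → H_n(X_t))`,
as a submodule of `H n t`. -/
abbrev persH (n s t : ℤ) : Submodule k (H n t) := LinearMap.range (f n s t)

/-- The persistent Betti number `b_n^{s,t}(F)`. -/
noncomputable def bPers (n s t : ℤ) : ℕ := Module.finrank k (persH f n s t)

/-- The cycle subspace `Z^{(r)}_{n,s} = ∂⁻¹(Im (i^{r-1} : H_{n-1}(X_{s-r}) → H_{n-1}(X_{s-1})))`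
of `E1 n s`. -/
abbrev Zpage (r : ℕ) (n s : ℤ) : Submodule k (E1 n s) :=
  Submodule.comap (bd n s) (LinearMap.range (f (n - 1) (s - (r : ℤ)) (s - 1)))

/-- The boundary subspace `B^{(r)}_{n,s} = p (ker (i^{r-1} : H_n(X_s) → H_n(X_{s+r-1})))`
of `E1 n s`. -/
abbrev Bpage (r : ℕ) (n s : ℤ) : Submodule k (E1 n s) :=
  Submodule.map (p n s) (LinearMap.ker (f n s (s + (r : ℤ) - 1)))

/-- The group `E^{(r)}_{n,s}(F)` of the `r`-th page of the homology spectral sequence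
of the filtration, `E^{(r)}_{n,s} = Z^{(r)}_{n,s} / B^{(r)}_{n,s}`. -/
abbrev Epage (r : ℕ) (n s : ℤ) : Type _ :=
  ↥(Zpage f bd r n s) ⧸
    Submodule.comap (Zpage f bd r n s).subtype (Bpage f p r n s)

/-- For each `r > 0` there is a long exact sequence
`⋯ → H_n^{s,s+r−1}(F) →p^{(r)} E^{(r)}_{n,s}(F) →∂^{(r)} H_{n−1}^{s−r,s−1}(F)
→i^{(r)} H_{n−1}^{s−r+1,s}(F) → ⋯` relating the `r`-th page of the homology spectral
sequence of `F` to its persistent homology groups; the maps are characterized by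
`p^{(r)}(i^{r−1} x) = [p x]`, `∂^{(r)}([z]) = ∂ z` and `i^{(r)}` being induced by the
inclusion maps of the filtration, exactness holds at every term, and moreover
`Im (i^{(r)}_{n,s}) = H_n^{s,s+r}(F)`. -/
theorem long_exact_sequence_Epage_persH
    (hf_id : ∀ n s : ℤ, f n s s = LinearMap.id)
    (hf_comp : ∀ (n s t u : ℤ), s ≤ t → t ≤ u → (f n t u) ∘ₗ (f n s t) = f n s u)
    (hzeroH : ∀ n s : ℤ, s ≤ 0 → Subsingleton (H n s))
    (hzeroE : ∀ n s : ℤ, s ≤ 0 ∨ (N : ℤ) < s → Subsingleton (E1 n s))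
    (hstable : ∀ n s t : ℤ, (N : ℤ) ≤ s → (N : ℤ) ≤ t → Function.Bijective (f n s t))
    (hexact_p : ∀ n s : ℤ, LinearMap.range (f n (s - 1) s) = LinearMap.ker (p n s))
    (hexact_bd : ∀ n s : ℤ, LinearMap.range (p n s) = LinearMap.ker (bd n s))
    (hexact_i : ∀ n s : ℤ, LinearMap.range (bd n s) = LinearMap.ker (f (n - 1) (s - 1) s))
    (r : ℕ) (hr : 1 ≤ r) :
    ∃ (pr : ∀ n s : ℤ, ↥(persH f n s (s + (r : ℤ) - 1)) →ₗ[k] Epage f p bd r n s)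
      (dr : ∀ n s : ℤ, Epage f p bd r n s →ₗ[k] ↥(persH f (n - 1) (s - (r : ℤ)) (s - 1)))
      (ir : ∀ (n a b a' b' : ℤ), ↥(persH f n a b) →ₗ[k] ↥(persH f n a' b')),
      -- `p^{(r)}_{n,s}` is induced by `p`:
      (∀ (n s : ℤ) (x : H n s) (hz : p n s x ∈ Zpage f bd r n s),
        pr n s ⟨f n s (s + (r : ℤ) - 1) x, ⟨x, rfl⟩⟩ =
          Submodule.Quotient.mk (⟨p n s x, hz⟩ : Zpage f bd r n s)) ∧
      -- `∂^{(r)}_{n,s}` is induced by `∂`: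
      (∀ (n s : ℤ) (z : Zpage f bd r n s),
        dr n s (Submodule.Quotient.mk z) = ⟨bd n s z.1, z.2⟩) ∧
      -- `i^{(r)}` is induced by the inclusion maps of the filtration:
      (∀ (n a b a' b' : ℤ), a' = a + 1 → b' = b + 1 → a ≤ b →
        ∀ y : persH f n a b, (ir n a b a' b' y : H n b') = f n b b' y.1) ∧
      -- exactness at `E^{(r)}_{n,s}`:
      (∀ n s : ℤ, LinearMap.range (pr n s) = LinearMap.ker (dr n s)) ∧
      -- exactness at `H_{n−1}^{s−r,s−1}`:
      (∀ n s : ℤ, LinearMap.range (dr n s) =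
        LinearMap.ker (ir (n - 1) (s - (r : ℤ)) (s - 1) (s - (r : ℤ) + 1) s)) ∧
      -- exactness at `H_n^{s,s+r−1}`:
      (∀ n s : ℤ, LinearMap.ker (pr n s) =
        LinearMap.range (ir n (s - 1) (s + (r : ℤ) - 2) s (s + (r : ℤ) - 1))) ∧
      -- `Im (i^{(r)}_{n,s}) = H_n^{s,s+r}(F)`:
      (∀ n s : ℤ, Submodule.map (persH f n (s + 1) (s + (r : ℤ))).subtype
          (LinearMap.range (ir n s (s + (r : ℤ) - 1) (s + 1) (s + (r : ℤ)))) =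
        persH f n s (s + (r : ℤ))) := by
  classical
  have hc : ∀ (n s t u : ℤ), s ≤ t → t ≤ u → ∀ x, f n t u (f n s t x) = f n s u x := by
    intro n s t u h1 h2 x
    rw [← hf_comp n s t u h1 h2]; rfl
  have hbp : ∀ (n s : ℤ) (x : H n s), bd n s (p n s x) = 0 := by
    intro n s x
    have : p n s x ∈ LinearMap.ker (bd n s) := by rw [← hexact_bd]; exact ⟨x, rfl⟩
    exact this
  have hpZ : ∀ (n s : ℤ) (x : H n s), p n s x ∈ Zpage f bd r n s := by
    intro n s x
    change bd n s (p n s x) ∈ LinearMap.range _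
    rw [hbp]; exact Submodule.zero_mem _
  have hr' : (1 : ℤ) ≤ (r : ℤ) := by exact_mod_cast hr
  -- the map induced by `p`
  have hpr : ∀ n s : ℤ, ∃ g : ↥(persH f n s (s + (r : ℤ) - 1)) →ₗ[k] Epage f p bd r n s,
      ∀ x : H n s, g ⟨f n s (s + (r : ℤ) - 1) x, ⟨x, rfl⟩⟩ =
        Submodule.Quotient.mk (⟨p n s x, hpZ n s x⟩ : Zpage f bd r n s) := by
    intro n s
    let q : H n s →ₗ[k] Epage f p bd r n s :=
      (Submodule.mkQ _) ∘ₗ ((p n s).codRestrict (Zpage f bd r n s) (hpZ n s))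
    have hq : LinearMap.ker (f n s (s + (r : ℤ) - 1)) ≤ LinearMap.ker q := by
      intro x hx
      rw [LinearMap.mem_ker]
      refine (Submodule.Quotient.mk_eq_zero _).2 ?_
      exact ⟨x, hx, rfl⟩
    refine ⟨(Submodule.liftQ _ q hq) ∘ₗ
      (f n s (s + (r : ℤ) - 1)).quotKerEquivRange.symm.toLinearMap, ?_⟩
    intro x
    have h1 : (f n s (s + (r : ℤ) - 1)).quotKerEquivRange.symm
        ⟨f n s (s + (r : ℤ) - 1) x, ⟨x, rfl⟩⟩ = Submodule.Quotient.mk x := by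
      rw [LinearEquiv.symm_apply_eq]
      rfl
    change Submodule.liftQ _ q hq ((f n s (s + (r : ℤ) - 1)).quotKerEquivRange.symm
        ⟨f n s (s + (r : ℤ) - 1) x, ⟨x, rfl⟩⟩) = _
    rw [h1]
    rfl
  choose pr hpr using hpr
  -- the map induced by `∂`
  have hdr : ∀ n s : ℤ, ∃ g : Epage f p bd r n s →ₗ[k]
      ↥(persH f (n - 1) (s - (r : ℤ)) (s - 1)),
      ∀ z : Zpage f bd r n s, g (Submodule.Quotient.mk z) = ⟨bd n s z.1, z.2⟩ := by
    intro n s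
    let q : Zpage f bd r n s →ₗ[k] ↥(persH f (n - 1) (s - (r : ℤ)) (s - 1)) :=
      ((bd n s) ∘ₗ (Zpage f bd r n s).subtype).codRestrict _ (fun z => z.2)
    refine ⟨Submodule.liftQ _ q ?_, fun z => rfl⟩
    rintro z ⟨x, -, hx⟩
    rw [LinearMap.mem_ker]
    apply Subtype.ext
    change bd n s z.1 = 0
    have hx' : p n s x = z.1 := hx
    rw [← hx', hbp]
  choose dr hdr using hdr
  -- the map induced by the inclusions
  have hir : ∀ (n a b a' b' : ℤ), ∃ g : ↥(persH f n a b) →ₗ[k] ↥(persH f n a' b'),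
      a' = a + 1 → b' = b + 1 → a ≤ b → ∀ y : persH f n a b, (g y : H n b') = f n b b' y.1 := by
    intro n a b a' b'
    by_cases h : a' = a + 1 ∧ b' = b + 1 ∧ a ≤ b
    · obtain ⟨h1, h2, h3⟩ := h
      refine ⟨((f n b b') ∘ₗ (persH f n a b).subtype).codRestrict _ ?_, fun _ _ _ y => rfl⟩
      rintro ⟨_, x, rfl⟩
      refine ⟨f n a a' x, ?_⟩
      change _ = f n b b' (f n a b x)
      rw [hc n a a' b' (by lia) (by lia), hc n a b b' (by lia) (by lia)]
    · exact ⟨0, fun h1 h2 h3 => absurd ⟨h1, h2, h3⟩ h⟩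
  choose ir hir using hir
  refine ⟨pr, dr, ir, fun n s x _ => hpr n s x, hdr, hir, ?_, ?_, ?_, ?_⟩
  · intro n s
    apply le_antisymm
    · rintro _ ⟨⟨_, x, rfl⟩, rfl⟩
      rw [LinearMap.mem_ker, hpr, hdr]
      exact Subtype.ext (hbp n s x)
    · intro e he
      obtain ⟨z, rfl⟩ := Submodule.Quotient.mk_surjective _ e
      rw [LinearMap.mem_ker, hdr] at he
      have hz : z.1 ∈ LinearMap.ker (bd n s) := congrArg Subtype.val he
      rw [← hexact_bd] at hz
      obtain ⟨x, hx⟩ := hz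
      refine ⟨⟨f n s (s + (r : ℤ) - 1) x, ⟨x, rfl⟩⟩, ?_⟩
      rw [hpr]
      exact congrArg _ (Subtype.ext hx)
  · intro n s
    have key := hir (n - 1) (s - (r : ℤ)) (s - 1) (s - (r : ℤ) + 1) s rfl (by lia) (by lia)
    apply le_antisymm
    · rintro _ ⟨e, rfl⟩
      obtain ⟨z, rfl⟩ := Submodule.Quotient.mk_surjective _ e
      rw [LinearMap.mem_ker, hdr]
      apply Subtype.ext
      rw [key]
      have : bd n s z.1 ∈ LinearMap.ker (f (n - 1) (s - 1) s) := by
        rw [← hexact_i]; exact ⟨_, rfl⟩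
      exact this
    · intro y hy
      have h1 : y.1 ∈ LinearMap.ker (f (n - 1) (s - 1) s) := by
        rw [LinearMap.mem_ker, ← key, LinearMap.mem_ker.1 hy]; rfl
      rw [← hexact_i] at h1
      obtain ⟨z, hz⟩ := h1
      have hzZ : z ∈ Zpage f bd r n s := by
        change bd n s z ∈ LinearMap.range _
        rw [hz]; exact y.2
      refine ⟨Submodule.Quotient.mk ⟨z, hzZ⟩, ?_⟩
      rw [hdr]
      exact Subtype.ext hz
  · intro n s
    have key := hir n (s - 1) (s + (r : ℤ) - 2) s (s + (r : ℤ) - 1)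
      (by lia) (by lia) (by lia)
    apply le_antisymm
    · rintro ⟨_, x, rfl⟩ hx
      rw [LinearMap.mem_ker, hpr, Submodule.Quotient.mk_eq_zero] at hx
      obtain ⟨x', hx', hxx⟩ := hx
      have hxx' : p n s x' = p n s x := hxx
      have h1 : x - x' ∈ LinearMap.ker (p n s) := by
        rw [LinearMap.mem_ker, map_sub, hxx', sub_self]
      rw [← hexact_p] at h1
      obtain ⟨w, hw⟩ := h1
      refine ⟨⟨f n (s - 1) (s + (r : ℤ) - 2) w, ⟨w, rfl⟩⟩, ?_⟩
      apply Subtype.ext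
      rw [key]
      change f n _ _ (f n _ _ w) = f n _ _ x
      rw [hc n _ _ _ (by lia) (by lia), ← hc n (s - 1) s _ (by lia) (by lia), hw, map_sub,
        LinearMap.mem_ker.1 hx', sub_zero]
    · rintro _ ⟨⟨_, w, rfl⟩, rfl⟩
      have h1 : ir n (s - 1) (s + (r : ℤ) - 2) s (s + (r : ℤ) - 1)
          ⟨f n (s - 1) (s + (r : ℤ) - 2) w, ⟨w, rfl⟩⟩ =
          ⟨f n s (s + (r : ℤ) - 1) (f n (s - 1) s w), ⟨_, rfl⟩⟩ := by
        apply Subtype.ext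
        rw [key]
        change f n _ _ (f n _ _ w) = f n _ _ (f n _ _ w)
        rw [hc n _ _ _ (by lia) (by lia), hc n _ _ _ (by lia) (by lia)]
      rw [LinearMap.mem_ker, h1, hpr, Submodule.Quotient.mk_eq_zero]
      have h2 : f n (s - 1) s w ∈ LinearMap.ker (p n s) := by
        rw [← hexact_p]; exact ⟨w, rfl⟩
      refine ⟨0, Submodule.zero_mem _, ?_⟩
      rw [map_zero]
      exact (LinearMap.mem_ker.1 h2).symm
  · intro n s
    have key := hir n s (s + (r : ℤ) - 1) (s + 1) (s + (r : ℤ)) rfl (by lia) (by lia)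
    apply le_antisymm
    · rintro _ ⟨_, ⟨⟨_, x, rfl⟩, rfl⟩, rfl⟩
      refine ⟨x, ?_⟩
      rw [Submodule.subtype_apply, key]
      exact (hc n _ _ _ (by lia) (by lia) x).symm
    · rintro _ ⟨x, rfl⟩
      refine ⟨_, ⟨⟨f n s (s + (r : ℤ) - 1) x, ⟨x, rfl⟩⟩, rfl⟩, ?_⟩
      rw [Submodule.subtype_apply, key]
      exact hc n _ _ _ (by lia) (by lia) x
end

section
/- For a finite filtration F of finite CW-complexes, for every r > 0 and n, s ≥ 0: dim_k E^{(r)}_{n,s}(F) = (b_n^{s,s+r−1}(F) − b_n^{s−1,s+r−1}(F)) + (b_{n−1}^{s−r,s−1}(F) − b_{n−1}^{s−r,s}(F)), where b_n^{s,t}(F) = dim_k Im(H_n(X_s) → H_n(X_t)) are the persistent Betti numbers (with the convention b_n^{s,t} = 0 when s ≤ 0). -/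
set_option autoImplicit false

/-!
We model a finite filtration `∅ = X₀ ⊂ X₁ ⊂ ⋯ ⊂ X_N = X` of finite CW-complexes
(homology with coefficients in a field `k`) by the algebraic data it induces:
* `H n s` plays the role of `H_n(X_s)` and `E1 n s` that of `H_n(X_s, X_{s-1})`;
* `f n s t : H n s →ₗ[k] H n t` is the map induced by inclusion (for `s ≤ t`);
* `p n s : H n s →ₗ[k] E1 n s` and `bd n s : E1 n s →ₗ[k] H (n-1) (s-1)` are the maps
  of the long exact homology sequences of the pairs `(X_s, X_{s-1})`.
The hypotheses `hf_id`, `hf_comp` (functoriality), `hzeroH`, `hzeroE` (`X_s = ∅` for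
`s ≤ 0` and `X_s = X_N` for `s ≥ N`), `hstable`, and `hexact_p`, `hexact_bd`,
`hexact_i` (exactness of the long exact sequences) appearing in the theorems below
express exactly these facts.
-/

universe u v

variable {k : Type u} [Field k] (N : ℕ)
variable {H : ℤ → ℤ → Type v} [∀ n s, AddCommGroup (H n s)] [∀ n s, Module k (H n s)]
  [∀ n s, FiniteDimensional k (H n s)]
variable {E1 : ℤ → ℤ → Type v} [∀ n s, AddCommGroup (E1 n s)] [∀ n s, Module k (E1 n s)]
  [∀ n s, FiniteDimensional k (E1 n s)]
variable (f : ∀ n s t : ℤ, H n s →ₗ[k] H n t)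
variable (p : ∀ n s : ℤ, H n s →ₗ[k] E1 n s)
variable (bd : ∀ n s : ℤ, E1 n s →ₗ[k] H (n - 1) (s - 1))

/-- Rank-nullity for a linear map restricted to a submodule. -/
theorem finrank_map_add_finrank_inf_ker {K V W : Type*} [Field K] [AddCommGroup V] [Module K V]
    [FiniteDimensional K V] [AddCommGroup W] [Module K W] (g : V →ₗ[K] W) (A : Submodule K V) :
    Module.finrank K (A.map g) + Module.finrank K (A ⊓ LinearMap.ker g : Submodule K V) =
      Module.finrank K A := by
  have h := LinearMap.finrank_range_add_finrank_ker (g.domRestrict A)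
  have h1 : LinearMap.range (g.domRestrict A) = A.map g := by
    rw [LinearMap.domRestrict, LinearMap.range_comp, Submodule.range_subtype]
  have h2 : (LinearMap.ker (g.domRestrict A)).map A.subtype = A ⊓ LinearMap.ker g := by
    rw [LinearMap.domRestrict, LinearMap.ker_comp, Submodule.map_comap_subtype]
  rw [← h1, ← h2, Submodule.finrank_map_subtype_eq]
  exact h

/-- `dim_k E^{(r)}_{n,s}(F) = (b_n^{s,s+r−1} − b_n^{s−1,s+r−1}) + (b_{n−1}^{s−r,s−1} − b_{n−1}^{s−r,s})`. -/
theorem dim_Epage_eq_persistent_betti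
    (hf_id : ∀ n s : ℤ, f n s s = LinearMap.id)
    (hf_comp : ∀ (n s t u : ℤ), s ≤ t → t ≤ u → (f n t u) ∘ₗ (f n s t) = f n s u)
    (hzeroH : ∀ n s : ℤ, s ≤ 0 → Subsingleton (H n s))
    (hzeroE : ∀ n s : ℤ, s ≤ 0 ∨ (N : ℤ) < s → Subsingleton (E1 n s))
    (hstable : ∀ n s t : ℤ, (N : ℤ) ≤ s → (N : ℤ) ≤ t → Function.Bijective (f n s t))
    (hexact_p : ∀ n s : ℤ, LinearMap.range (f n (s - 1) s) = LinearMap.ker (p n s))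
    (hexact_bd : ∀ n s : ℤ, LinearMap.range (p n s) = LinearMap.ker (bd n s))
    (hexact_i : ∀ n s : ℤ, LinearMap.range (bd n s) = LinearMap.ker (f (n - 1) (s - 1) s))
    (r : ℕ) (n s : ℤ) (hr : 1 ≤ r) (hn : 0 ≤ n) (hs : 0 ≤ s) :
    (Module.finrank k (Epage f p bd r n s) : ℤ) =
      ((bPers f n s (s + (r : ℤ) - 1) : ℤ) - (bPers f n (s - 1) (s + (r : ℤ) - 1) : ℤ)) +
        ((bPers f (n - 1) (s - (r : ℤ)) (s - 1) : ℤ) - (bPers f (n - 1) (s - (r : ℤ)) s : ℤ)) := by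
  have hle : Bpage f p r n s ≤ Zpage f bd r n s := by
    rintro _ ⟨x, -, rfl⟩
    have hx : p n s x ∈ LinearMap.ker (bd n s) := hexact_bd n s ▸ LinearMap.mem_range_self _ x
    rw [Submodule.mem_comap, LinearMap.mem_ker.mp hx]
    exact Submodule.zero_mem _
  -- dimension of the quotient
  have hE := Submodule.finrank_quotient_add_finrank
    (Submodule.comap (Zpage f bd r n s).subtype (Bpage f p r n s))
  have hB' : Module.finrank k
      (Submodule.comap (Zpage f bd r n s).subtype (Bpage f p r n s)) =
      Module.finrank k (Bpage f p r n s) :=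
    (Submodule.comapSubtypeEquivOfLe hle).finrank_eq
  -- dimension of `Z`
  have hZ := finrank_map_add_finrank_inf_ker (bd n s) (Zpage f bd r n s)
  have hZ1 : (Zpage f bd r n s).map (bd n s) =
      LinearMap.range (f (n - 1) (s - (r : ℤ)) (s - 1)) ⊓
        LinearMap.ker (f (n - 1) (s - 1) s) := by
    rw [Submodule.map_comap_eq, hexact_i, inf_comm]
  have hZ2 : Zpage f bd r n s ⊓ LinearMap.ker (bd n s) = LinearMap.range (p n s) := by
    rw [hexact_bd, inf_eq_right]
    exact Submodule.comap_mono bot_le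
  rw [hZ1, hZ2] at hZ
  have hA := finrank_map_add_finrank_inf_ker (f (n - 1) (s - 1) s)
    (LinearMap.range (f (n - 1) (s - (r : ℤ)) (s - 1)))
  rw [← LinearMap.range_comp, hf_comp _ _ _ _ (by omega) (by omega)] at hA
  -- dimension of `B`
  have hp := LinearMap.finrank_range_add_finrank_ker (p n s)
  have hB := finrank_map_add_finrank_inf_ker (p n s) (LinearMap.ker (f n s (s + (r : ℤ) - 1)))
  have hF := LinearMap.finrank_range_add_finrank_ker (f n s (s + (r : ℤ) - 1))
  have hI := finrank_map_add_finrank_inf_ker (f n s (s + (r : ℤ) - 1))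
    (LinearMap.range (f n (s - 1) s))
  rw [← LinearMap.range_comp, hf_comp _ _ _ _ (by omega) (by omega)] at hI
  rw [← hexact_p, inf_comm] at hB
  rw [← hexact_p] at hp
  unfold bPers persH
  rw [hB'] at hE
  change Module.finrank k (Bpage f p r n s) + _ = _ at hB
  unfold Epage
  omega
end

section
/- For a finite filtration F of finite CW-complexes and all r > 0, n ≥ 0: Σ_s dim_k E^{(r)}_{n,s}(F) = Σ_{j−i ≥ r} (μ_n^{i,j}(F) + μ_{n−1}^{i,j}(F)) + b_n(X), where μ_n^{i,j}(F) = (b_n^{i,j−1} − b_n^{i,j}) − (b_n^{i−1,j−1} − b_n^{i−1,j}) are the persistent multiplicities and b_n(X) is the n-th Betti number of X = X_N. -/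
set_option autoImplicit false

/-!
We model a finite filtration `∅ = X₀ ⊂ X₁ ⊂ ⋯ ⊂ X_N = X` of finite CW-complexes
(homology with coefficients in a field `k`) by the algebraic data it induces:
* `H n s` plays the role of `H_n(X_s)` and `E1 n s` that of `H_n(X_s, X_{s-1})`;
* `f n s t : H n s →ₗ[k] H n t` is the map induced by inclusion (for `s ≤ t`);
* `p n s : H n s →ₗ[k] E1 n s` and `bd n s : E1 n s →ₗ[k] H (n-1) (s-1)` are the maps
  of the long exact homology sequences of the pairs `(X_s, X_{s-1})`.
The hypotheses `hf_id`, `hf_comp` (functoriality), `hzeroH`, `hzeroE` (`X_s = ∅` for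
`s ≤ 0` and `X_s = X_N` for `s ≥ N`), `hstable`, and `hexact_p`, `hexact_bd`,
`hexact_i` (exactness of the long exact sequences) appearing in the theorems below
express exactly these facts.
-/

universe u v

variable {k : Type u} [Field k] (N : ℕ)
variable {H : ℤ → ℤ → Type v} [∀ n s, AddCommGroup (H n s)] [∀ n s, Module k (H n s)]
  [∀ n s, FiniteDimensional k (H n s)]
variable {E1 : ℤ → ℤ → Type v} [∀ n s, AddCommGroup (E1 n s)] [∀ n s, Module k (E1 n s)]
  [∀ n s, FiniteDimensional k (E1 n s)]
variable (f : ∀ n s t : ℤ, H n s →ₗ[k] H n t)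
variable (p : ∀ n s : ℤ, H n s →ₗ[k] E1 n s)
variable (bd : ∀ n s : ℤ, E1 n s →ₗ[k] H (n - 1) (s - 1))

/-- The persistent multiplicity `μ_n^{i,j}(F)`. -/
noncomputable def muPers (n i j : ℤ) : ℤ :=
  ((bPers f n i (j - 1) : ℤ) - (bPers f n i j : ℤ)) -
    ((bPers f n (i - 1) (j - 1) : ℤ) - (bPers f n (i - 1) j : ℤ))

theorem aux_finrank_map {K V W : Type*} [Field K] [AddCommGroup V] [Module K V]
    [AddCommGroup W] [Module K W] [FiniteDimensional K V] (g : V →ₗ[K] W) (S : Submodule K V) :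
    Module.finrank K (S.map g) + Module.finrank K (S ⊓ LinearMap.ker g : Submodule K V)
      = Module.finrank K S := by
  have h := LinearMap.finrank_range_add_finrank_ker (g.domRestrict S)
  rw [LinearMap.range_domRestrict, LinearMap.ker_domRestrict] at h
  rw [← h]
  congr 1
  rw [← Submodule.finrank_map_subtype_eq S (Submodule.comap S.subtype (LinearMap.ker g)),
    Submodule.map_comap_subtype]

theorem aux_finrank_comap {K V W : Type*} [Field K] [AddCommGroup V] [Module K V]
    [AddCommGroup W] [Module K W] [FiniteDimensional K V] (g : V →ₗ[K] W) (S : Submodule K W) :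
    Module.finrank K (S.comap g) = Module.finrank K (LinearMap.range g ⊓ S : Submodule K W) +
      Module.finrank K (LinearMap.ker g) := by
  rw [← aux_finrank_map g (S.comap g), Submodule.map_comap_eq,
    inf_eq_right.mpr (LinearMap.ker_le_comap g)]

theorem aux_telescope (g : ℤ → ℤ) (a b : ℤ) (h : a - 1 ≤ b) :
    ∑ j ∈ Finset.Icc a b, (g (j - 1) - g j) = g (a - 1) - g b := by
  induction b, h using Int.leInduction with
  | base => simp
  | succ b hb ih =>
    have : Finset.Icc a (b + 1) = insert (b + 1) (Finset.Icc a b) := by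
      ext x; simp only [Finset.mem_Icc, Finset.mem_insert]; omega
    rw [this, Finset.sum_insert (by simp), ih]
    simp

theorem aux_finrank_Epage
    (hf_id : ∀ n s : ℤ, f n s s = LinearMap.id)
    (hf_comp : ∀ (n s t u : ℤ), s ≤ t → t ≤ u → (f n t u) ∘ₗ (f n s t) = f n s u)
    (hexact_p : ∀ n s : ℤ, LinearMap.range (f n (s - 1) s) = LinearMap.ker (p n s))
    (hexact_bd : ∀ n s : ℤ, LinearMap.range (p n s) = LinearMap.ker (bd n s))
    (hexact_i : ∀ n s : ℤ, LinearMap.range (bd n s) = LinearMap.ker (f (n - 1) (s - 1) s))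
    (r : ℕ) (n s : ℤ) (hr : 1 ≤ r) :
    (Module.finrank k (Epage f p bd r n s) : ℤ) =
      ((bPers f n s (s + r - 1) : ℤ) - bPers f n (s - 1) (s + r - 1)) +
      ((bPers f (n - 1) (s - r) (s - 1) : ℤ) - bPers f (n - 1) (s - r) s) := by
  have hBZ : Bpage f p r n s ≤ Zpage f bd r n s := by
    refine le_trans ?_ (LinearMap.ker_le_comap (bd n s))
    rw [← hexact_bd]
    exact LinearMap.map_le_range
  have hE : Module.finrank k (Epage f p bd r n s) + Module.finrank k (Bpage f p r n s)
      = Module.finrank k (Zpage f bd r n s) := by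
    rw [← Submodule.finrank_quotient_add_finrank
      (Submodule.comap (Zpage f bd r n s).subtype (Bpage f p r n s))]
    congr 1
    rw [← Submodule.finrank_map_subtype_eq, Submodule.map_comap_subtype, inf_eq_right.mpr hBZ]
  have hZ := aux_finrank_comap (bd n s) (LinearMap.range (f (n - 1) (s - (r : ℤ)) (s - 1)))
  rw [hexact_i, ← hexact_bd, inf_comm] at hZ
  have hZ2 := aux_finrank_map (f (n - 1) (s - 1) s)
    (LinearMap.range (f (n - 1) (s - (r : ℤ)) (s - 1)))
  rw [← LinearMap.range_comp, hf_comp _ _ _ _ (by omega) (by omega)] at hZ2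
  have hp := LinearMap.finrank_range_add_finrank_ker (p n s)
  rw [← hexact_p] at hp
  have hB := aux_finrank_map (p n s) (LinearMap.ker (f n s (s + (r : ℤ) - 1)))
  rw [← hexact_p, inf_comm] at hB
  have hk := LinearMap.finrank_range_add_finrank_ker (f n s (s + (r : ℤ) - 1))
  have hB2 := aux_finrank_map (f n s (s + (r : ℤ) - 1)) (LinearMap.range (f n (s - 1) s))
  rw [← LinearMap.range_comp, hf_comp _ _ _ _ (by omega) (by omega)] at hB2
  unfold Bpage Zpage at hE
  unfold bPers persH
  omega

/-- For all `r > 0`, `n ≥ 0`: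
`Σ_s dim_k E^{(r)}_{n,s}(F) = Σ_{j−i ≥ r} (μ_n^{i,j}(F) + μ_{n−1}^{i,j}(F)) + b_n(X)`,
where `b_n(X) = dim_k H_n(X_N)`. -/
theorem sum_dim_Epage_eq_sum_mu_add_betti
    (hf_id : ∀ n s : ℤ, f n s s = LinearMap.id)
    (hf_comp : ∀ (n s t u : ℤ), s ≤ t → t ≤ u → (f n t u) ∘ₗ (f n s t) = f n s u)
    (hzeroH : ∀ n s : ℤ, s ≤ 0 → Subsingleton (H n s))
    (hzeroE : ∀ n s : ℤ, s ≤ 0 ∨ (N : ℤ) < s → Subsingleton (E1 n s))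
    (hstable : ∀ n s t : ℤ, (N : ℤ) ≤ s → (N : ℤ) ≤ t → Function.Bijective (f n s t))
    (hexact_p : ∀ n s : ℤ, LinearMap.range (f n (s - 1) s) = LinearMap.ker (p n s))
    (hexact_bd : ∀ n s : ℤ, LinearMap.range (p n s) = LinearMap.ker (bd n s))
    (hexact_i : ∀ n s : ℤ, LinearMap.range (bd n s) = LinearMap.ker (f (n - 1) (s - 1) s))
    (r : ℕ) (n : ℤ) (hr : 1 ≤ r) (hn : 0 ≤ n) :
    (∑ s ∈ Finset.Icc (0 : ℤ) ((N : ℤ) + 1), (Module.finrank k (Epage f p bd r n s) : ℤ)) =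
      (∑ i ∈ Finset.Icc (0 : ℤ) ((N : ℤ) + 1), ∑ j ∈ Finset.Icc (0 : ℤ) ((N : ℤ) + 1),
          if (r : ℤ) ≤ j - i then muPers f n i j + muPers f (n - 1) i j else 0) +
        (Module.finrank k (H n (N : ℤ)) : ℤ) := by
  have hb0 : ∀ n i j : ℤ, i ≤ 0 → bPers f n i j = 0 := by
    intro n i j hi
    have := hzeroH n i hi
    have h := LinearMap.finrank_range_le (f n i j)
    rw [Module.finrank_zero_of_subsingleton (R := k) (M := H n i)] at h
    exact Nat.le_zero.mp h
  have hbst : ∀ n i t : ℤ, i ≤ (N : ℤ) + 1 → (N : ℤ) + 1 ≤ t →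
      bPers f n i t = bPers f n i ((N : ℤ) + 1) := by
    intro n i t hi ht
    unfold bPers persH
    rw [← hf_comp n i ((N : ℤ) + 1) t hi ht, LinearMap.range_comp]
    have h := aux_finrank_map (f n ((N : ℤ) + 1) t) (LinearMap.range (f n i ((N : ℤ) + 1)))
    rw [LinearMap.ker_eq_bot.mpr (hstable n ((N : ℤ) + 1) t (by omega) (by omega)).1,
      inf_bot_eq, finrank_bot] at h
    exact h
  have hbN : bPers f n ((N : ℤ) + 1) ((N : ℤ) + 1) = Module.finrank k (H n (N : ℤ)) := by
    unfold bPers persH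
    rw [hf_id, LinearMap.range_id, finrank_top]
    exact (LinearEquiv.finrank_eq
      (LinearEquiv.ofBijective _ (hstable n N ((N : ℤ) + 1) le_rfl (by omega)))).symm
  have key1 : ∀ i ∈ Finset.Icc (0 : ℤ) ((N : ℤ) + 1),
      (∑ j ∈ Finset.Icc (0 : ℤ) ((N : ℤ) + 1), if (r : ℤ) ≤ j - i then muPers f n i j else 0)
      = ((bPers f n i (i + r - 1) : ℤ) - bPers f n (i - 1) (i + r - 1)) +
        ((bPers f n (i - 1) ((N : ℤ) + 1) : ℤ) - bPers f n i ((N : ℤ) + 1)) := by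
    intro i hi
    rw [Finset.mem_Icc] at hi
    rw [← Finset.sum_filter]
    have : (Finset.Icc (0 : ℤ) ((N : ℤ) + 1)).filter (fun j => (r : ℤ) ≤ j - i)
        = Finset.Icc (i + r) ((N : ℤ) + 1) := by
      ext x; simp only [Finset.mem_filter, Finset.mem_Icc]; omega
    rw [this]
    by_cases h : i + r - 1 ≤ (N : ℤ) + 1
    · have := aux_telescope (fun j => (bPers f n i j : ℤ) - bPers f n (i - 1) j) (i + r)
        ((N : ℤ) + 1) h
      have h2 : ∀ j, muPers f n i j = ((bPers f n i (j - 1) : ℤ) - bPers f n (i - 1) (j - 1)) -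
          ((bPers f n i j : ℤ) - bPers f n (i - 1) j) := by
        intro j; unfold muPers; ring
      simp only [h2]
      rw [this]; ring
    · rw [Finset.Icc_eq_empty (by omega), Finset.sum_empty,
        hbst n i (i + r - 1) (by omega) (by omega), hbst n (i - 1) (i + r - 1) (by omega) (by omega)]
      ring
  have key2 : ∀ j ∈ Finset.Icc (0 : ℤ) ((N : ℤ) + 1),
      (∑ i ∈ Finset.Icc (0 : ℤ) ((N : ℤ) + 1),
        if (r : ℤ) ≤ j - i then muPers f (n - 1) i j else 0)
      = (bPers f (n - 1) (j - r) (j - 1) : ℤ) - bPers f (n - 1) (j - r) j := by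
    intro j hj
    rw [Finset.mem_Icc] at hj
    rw [← Finset.sum_filter]
    have : (Finset.Icc (0 : ℤ) ((N : ℤ) + 1)).filter (fun i => (r : ℤ) ≤ j - i)
        = Finset.Icc 0 (j - r) := by
      ext x; simp only [Finset.mem_filter, Finset.mem_Icc]; omega
    rw [this]
    by_cases h : 0 - 1 ≤ j - (r : ℤ)
    · have := aux_telescope (fun i => (bPers f (n - 1) i j : ℤ) - bPers f (n - 1) i (j - 1)) 0
        (j - r) h
      have h2 : ∀ i, muPers f (n - 1) i j =
          ((bPers f (n - 1) (i - 1) j : ℤ) - bPers f (n - 1) (i - 1) (j - 1)) -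
          ((bPers f (n - 1) i j : ℤ) - bPers f (n - 1) i (j - 1)) := by
        intro j; unfold muPers; ring
      simp only [h2]
      rw [this, hb0 (n - 1) (0 - 1) _ (by omega), hb0 (n - 1) (0 - 1) _ (by omega)]; ring
    · rw [Finset.Icc_eq_empty (by omega), Finset.sum_empty,
        hb0 _ (j - r) _ (by omega), hb0 _ (j - r) _ (by omega)]
      ring
  have key3 := aux_telescope (fun i => (bPers f n i ((N : ℤ) + 1) : ℤ)) 0 ((N : ℤ) + 1) (by omega)
  rw [hb0 n (0 - 1) _ (by omega), hbN] at key3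
  have hsplit : (∑ i ∈ Finset.Icc (0 : ℤ) ((N : ℤ) + 1), ∑ j ∈ Finset.Icc (0 : ℤ) ((N : ℤ) + 1),
          if (r : ℤ) ≤ j - i then muPers f n i j + muPers f (n - 1) i j else 0) =
      (∑ i ∈ Finset.Icc (0 : ℤ) ((N : ℤ) + 1), ∑ j ∈ Finset.Icc (0 : ℤ) ((N : ℤ) + 1),
          if (r : ℤ) ≤ j - i then muPers f n i j else 0) +
      ∑ j ∈ Finset.Icc (0 : ℤ) ((N : ℤ) + 1), ∑ i ∈ Finset.Icc (0 : ℤ) ((N : ℤ) + 1),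
          if (r : ℤ) ≤ j - i then muPers f (n - 1) i j else 0 := by
    rw [Finset.sum_comm (f := fun j i => if (r : ℤ) ≤ j - i then muPers f (n - 1) i j else 0),
      ← Finset.sum_add_distrib]
    refine Finset.sum_congr rfl fun i _ => ?_
    rw [← Finset.sum_add_distrib]
    refine Finset.sum_congr rfl fun j _ => ?_
    split_ifs <;> simp
  rw [hsplit, Finset.sum_congr rfl key1, Finset.sum_congr rfl key2,
    Finset.sum_congr rfl (fun s _ => aux_finrank_Epage f p bd hf_id hf_comp hexact_p hexact_bd
      hexact_i r n s hr), Finset.sum_add_distrib, Finset.sum_add_distrib, key3]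
  push_cast
  ring
end

section
/- For a finite filtration F of length N and all n, s, t with 0 ≤ s ≤ t ≤ N, the persistent Betti number satisfies b_n^{s,t}(F) = Σ_{0 ≤ i ≤ s} dim_k E^{(max(i, t−i+1))}_{n,i}(F_{≤t}), where F_{≤t} is the truncated filtration stopping at X_t. -/
set_option autoImplicit false

/-!
We model a finite filtration `∅ = X₀ ⊂ X₁ ⊂ ⋯ ⊂ X_N = X` of finite CW-complexes
(homology with coefficients in a field `k`) by the algebraic data it induces:
* `H n s` plays the role of `H_n(X_s)` and `E1 n s` that of `H_n(X_s, X_{s-1})`;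
* `f n s t : H n s →ₗ[k] H n t` is the map induced by inclusion (for `s ≤ t`);
* `p n s : H n s →ₗ[k] E1 n s` and `bd n s : E1 n s →ₗ[k] H (n-1) (s-1)` are the maps
  of the long exact homology sequences of the pairs `(X_s, X_{s-1})`.
The hypotheses `hf_id`, `hf_comp` (functoriality), `hzeroH`, `hzeroE` (`X_s = ∅` for
`s ≤ 0` and `X_s = X_N` for `s ≥ N`), `hstable`, and `hexact_p`, `hexact_bd`,
`hexact_i` (exactness of the long exact sequences) appearing in the theorems below
express exactly these facts.
-/

universe u v

variable {k : Type u} [Field k] (N : ℕ)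
variable {H : ℤ → ℤ → Type v} [∀ n s, AddCommGroup (H n s)] [∀ n s, Module k (H n s)]
  [∀ n s, FiniteDimensional k (H n s)]
variable {E1 : ℤ → ℤ → Type v} [∀ n s, AddCommGroup (E1 n s)] [∀ n s, Module k (E1 n s)]
  [∀ n s, FiniteDimensional k (E1 n s)]
variable (f : ∀ n s t : ℤ, H n s →ₗ[k] H n t)
variable (p : ∀ n s : ℤ, H n s →ₗ[k] E1 n s)
variable (bd : ∀ n s : ℤ, E1 n s →ₗ[k] H (n - 1) (s - 1))

/-- The boundary subspace `B^{(r)}_{n,s}` for the truncated filtration `F_{≤t}`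
(for `s ≤ t`): since `X'_u = X_{min u t}`, it is `p (ker (i : H_n(X_s) → H_n(X_{min(s+r−1) t})))`. -/
abbrev BpageT (t : ℤ) (r : ℕ) (n s : ℤ) : Submodule k (E1 n s) :=
  Submodule.map (p n s) (LinearMap.ker (f n s (min (s + (r : ℤ) - 1) t)))

/-- The group `E^{(r)}_{n,s}(F_{≤t})` of the `r`-th page of the spectral sequence of the
truncated filtration `F_{≤t}`, for `s ≤ t` (in that range the cycle subspace `Z^{(r)}_{n,s}`
is unchanged by truncation). -/
abbrev EpageT (t : ℤ) (r : ℕ) (n s : ℤ) : Type _ :=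
  ↥(Zpage f bd r n s) ⧸
    Submodule.comap (Zpage f bd r n s).subtype (BpageT f p t r n s)

theorem finrank_map_add_inf_ker {K B D : Type*} [Field K] [AddCommGroup B] [Module K B]
    [FiniteDimensional K B] [AddCommGroup D] [Module K D] (q : B →ₗ[K] D) (U : Submodule K B) :
    Module.finrank K (U.map q) + Module.finrank K ↥(U ⊓ LinearMap.ker q) = Module.finrank K U := by
  have h := LinearMap.finrank_range_add_finrank_ker (q.domRestrict U)
  rw [LinearMap.range_domRestrict, LinearMap.ker_domRestrict] at h
  rw [← h, ← Submodule.map_comap_subtype]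
  congr 1
  exact (Submodule.equivMapOfInjective _ (Submodule.subtype_injective U) _).finrank_eq.symm

theorem finrank_four_term {K A B C D : Type*} [Field K] [AddCommGroup A] [Module K A]
    [AddCommGroup B] [Module K B] [FiniteDimensional K B] [AddCommGroup C] [Module K C]
    [AddCommGroup D] [Module K D] (g : A →ₗ[K] B) (h : B →ₗ[K] C) (q : B →ₗ[K] D)
    (hq : LinearMap.range g = LinearMap.ker q) :
    Module.finrank K (LinearMap.range h) + Module.finrank K ((LinearMap.ker h).map q) =
      Module.finrank K (LinearMap.range q) + Module.finrank K (LinearMap.range (h ∘ₗ g)) := by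
  have h1 := finrank_map_add_inf_ker q (LinearMap.ker h)
  have h2 := finrank_map_add_inf_ker h (LinearMap.ker q)
  have h3 := LinearMap.finrank_range_add_finrank_ker h
  have h4 := LinearMap.finrank_range_add_finrank_ker q
  rw [LinearMap.range_comp, hq]
  rw [inf_comm] at h2
  omega

theorem finrank_quot_comap {K E : Type*} [Field K] [AddCommGroup E] [Module K E]
    [FiniteDimensional K E] (Z B : Submodule K E) (h : B ≤ Z) :
    Module.finrank K (↥Z ⧸ B.comap Z.subtype) + Module.finrank K B = Module.finrank K Z := by
  rw [← (Submodule.comapSubtypeEquivOfLe h).finrank_eq]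
  exact Submodule.finrank_quotient_add_finrank _

/-- For all `0 ≤ s ≤ t ≤ N` and `n ≥ 0`:
`b_n^{s,t}(F) = Σ_{0 ≤ i ≤ s} dim_k E^{(max(i, t−i+1))}_{n,i}(F_{≤t})`. -/
theorem bPers_eq_sum_dim_Epage_truncated
    (hf_id : ∀ n s : ℤ, f n s s = LinearMap.id)
    (hf_comp : ∀ (n s t u : ℤ), s ≤ t → t ≤ u → (f n t u) ∘ₗ (f n s t) = f n s u)
    (hzeroH : ∀ n s : ℤ, s ≤ 0 → Subsingleton (H n s))
    (hzeroE : ∀ n s : ℤ, s ≤ 0 ∨ (N : ℤ) < s → Subsingleton (E1 n s))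
    (hstable : ∀ n s t : ℤ, (N : ℤ) ≤ s → (N : ℤ) ≤ t → Function.Bijective (f n s t))
    (hexact_p : ∀ n s : ℤ, LinearMap.range (f n (s - 1) s) = LinearMap.ker (p n s))
    (hexact_bd : ∀ n s : ℤ, LinearMap.range (p n s) = LinearMap.ker (bd n s))
    (hexact_i : ∀ n s : ℤ, LinearMap.range (bd n s) = LinearMap.ker (f (n - 1) (s - 1) s))
    (n s t : ℤ) (hn : 0 ≤ n) (hs : 0 ≤ s) (hst : s ≤ t) (htN : t ≤ (N : ℤ)) :
    bPers f n s t =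
      ∑ i ∈ Finset.Icc (0 : ℤ) s,
        Module.finrank k (EpageT f p bd t (max i (t - i + 1)).toNat n i) := by
  have step : ∀ i : ℤ, 0 ≤ i → i ≤ t → bPers f n i t = bPers f n (i - 1) t +
      Module.finrank k (EpageT f p bd t (max i (t - i + 1)).toNat n i) := by
    intro i hi hit
    have hr : (((max i (t - i + 1)).toNat : ℕ) : ℤ) = max i (t - i + 1) := by omega
    have hZ : Zpage f bd (max i (t - i + 1)).toNat n i = LinearMap.range (p n i) := by
      have : Subsingleton (H (n - 1) (i - (((max i (t - i + 1)).toNat : ℕ) : ℤ))) :=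
        hzeroH _ _ (by omega)
      have h0 : LinearMap.range
          (f (n - 1) (i - (((max i (t - i + 1)).toNat : ℕ) : ℤ)) (i - 1)) = ⊥ := by
        rw [LinearMap.range_eq_bot]
        exact Subsingleton.elim _ _
      unfold Zpage
      rw [h0, hexact_bd]
      rfl
    have hB : BpageT f p t (max i (t - i + 1)).toNat n i =
        Submodule.map (p n i) (LinearMap.ker (f n i t)) := by
      have : min (i + (((max i (t - i + 1)).toNat : ℕ) : ℤ) - 1) t = t := by omega
      unfold BpageT
      rw [this]
    have hle : BpageT f p t (max i (t - i + 1)).toNat n i ≤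
        Zpage f bd (max i (t - i + 1)).toNat n i := by
      rw [hZ, hB]
      exact LinearMap.map_le_range
    have h1 := finrank_quot_comap _ _ hle
    have h2 := finrank_four_term (f n (i - 1) i) (f n i t) (p n i) (hexact_p n i)
    rw [hf_comp n (i - 1) i t (by omega) hit] at h2
    have e1 := congrArg (fun S : Submodule k (E1 n i) => Module.finrank k S) hZ
    have e2 := congrArg (fun S : Submodule k (E1 n i) => Module.finrank k S) hB
    change _ = Module.finrank k (LinearMap.range (p n i)) at e1
    change _ = Module.finrank k (Submodule.map (p n i) (LinearMap.ker (f n i t))) at e2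
    have h3 := (congrArg₂ (fun a b : ℕ => Module.finrank k
      (EpageT f p bd t (max i (t - i + 1)).toNat n i) + a = b) e2 e1).mp h1
    change Module.finrank k (LinearMap.range (f n i t)) =
      Module.finrank k (LinearMap.range (f n (i - 1) t)) + _
    omega
  have main : ∀ m : ℕ, (m : ℤ) ≤ t → bPers f n m t = ∑ i ∈ Finset.Icc (0 : ℤ) m,
        Module.finrank k (EpageT f p bd t (max i (t - i + 1)).toNat n i) := by
    intro m
    induction m with
    | zero =>
      intro h
      have := step 0 le_rfl (by simpa using h)
      have hs0 : Subsingleton (H n (0 - 1)) := hzeroH _ _ (by omega)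
      have h0 : bPers f n (0 - 1) t = 0 := by
        have : f n (0 - 1) t = 0 := Subsingleton.elim _ _
        unfold bPers persH
        rw [this, LinearMap.range_zero, finrank_bot]
      rw [h0, zero_add] at this
      simp only [Nat.cast_zero, Finset.Icc_self, Finset.sum_singleton]
      exact this
    | succ m ih =>
      intro h
      have hm := step ((m + 1 : ℕ) : ℤ) (by omega) h
      have hI : Finset.Icc (0 : ℤ) ((m + 1 : ℕ) : ℤ) =
          insert (((m + 1 : ℕ) : ℤ)) (Finset.Icc (0 : ℤ) m) := by
        ext x
        simp only [Finset.mem_Icc, Finset.mem_insert]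
        omega
      have hpred : ((m + 1 : ℕ) : ℤ) - 1 = m := by omega
      rw [hI, Finset.sum_insert (by simp), ← ih (by omega), hm, hpred, add_comm]
  obtain ⟨m, rfl⟩ := Int.eq_ofNat_of_zero_le hs
  exact main m hst
end

section
/- For a finite filtration F of length N, for r ≥ max(s, N−s+1) the quantity (b_n^{s,s+r−1} − b_n^{s−1,s+r−1}) + (b_{n−1}^{s−r,s−1} − b_{n−1}^{s−r,s}) equals b_n^{s,N} − b_n^{s−1,N} = dim_k Gr_{n,s}(H_n(X)); i.e. the formula for dim E^{(r)}_{n,s} stabilizes to the dimension of the associated graded of H_n(X). -/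
set_option autoImplicit false

/-!
We model a finite filtration `∅ = X₀ ⊂ X₁ ⊂ ⋯ ⊂ X_N = X` of finite CW-complexes
(homology with coefficients in a field `k`) by the algebraic data it induces:
* `H n s` plays the role of `H_n(X_s)` and `E1 n s` that of `H_n(X_s, X_{s-1})`;
* `f n s t : H n s →ₗ[k] H n t` is the map induced by inclusion (for `s ≤ t`);
* `p n s : H n s →ₗ[k] E1 n s` and `bd n s : E1 n s →ₗ[k] H (n-1) (s-1)` are the maps
  of the long exact homology sequences of the pairs `(X_s, X_{s-1})`.
The hypotheses `hf_id`, `hf_comp` (functoriality), `hzeroH`, `hzeroE` (`X_s = ∅` for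
`s ≤ 0` and `X_s = X_N` for `s ≥ N`), `hstable`, and `hexact_p`, `hexact_bd`,
`hexact_i` (exactness of the long exact sequences) appearing in the theorems below
express exactly these facts.
-/

universe u v

variable {k : Type u} [Field k] (N : ℕ)
variable {H : ℤ → ℤ → Type v} [∀ n s, AddCommGroup (H n s)] [∀ n s, Module k (H n s)]
  [∀ n s, FiniteDimensional k (H n s)]
variable {E1 : ℤ → ℤ → Type v} [∀ n s, AddCommGroup (E1 n s)] [∀ n s, Module k (E1 n s)]
  [∀ n s, FiniteDimensional k (E1 n s)]
variable (f : ∀ n s t : ℤ, H n s →ₗ[k] H n t)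
variable (p : ∀ n s : ℤ, H n s →ₗ[k] E1 n s)
variable (bd : ∀ n s : ℤ, E1 n s →ₗ[k] H (n - 1) (s - 1))

/-- The graded piece `Gr_{n,s}(H_n(X)) = Im(i_n^{s,N}) / Im(i_n^{s−1,N})` of the
filtration `F_s H_n(X) = Im(i_n^{s,N})` of `H_n(X) = H_n(X_N)`. -/
abbrev GrH (n s : ℤ) : Type _ :=
  ↥(persH f n s (N : ℤ)) ⧸
    Submodule.comap (persH f n s (N : ℤ)).subtype (persH f n (s - 1) (N : ℤ))

/-- For `r ≥ max(s, N−s+1)` the quantity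
`(b_n^{s,s+r−1} − b_n^{s−1,s+r−1}) + (b_{n−1}^{s−r,s−1} − b_{n−1}^{s−r,s})`
(the formula for `dim_k E^{(r)}_{n,s}`) equals
`b_n^{s,N} − b_n^{s−1,N} = dim_k Gr_{n,s}(H_n(X))`. -/
theorem dim_Epage_formula_stabilizes
    (hf_id : ∀ n s : ℤ, f n s s = LinearMap.id)
    (hf_comp : ∀ (n s t u : ℤ), s ≤ t → t ≤ u → (f n t u) ∘ₗ (f n s t) = f n s u)
    (hzeroH : ∀ n s : ℤ, s ≤ 0 → Subsingleton (H n s))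
    (hzeroE : ∀ n s : ℤ, s ≤ 0 ∨ (N : ℤ) < s → Subsingleton (E1 n s))
    (hstable : ∀ n s t : ℤ, (N : ℤ) ≤ s → (N : ℤ) ≤ t → Function.Bijective (f n s t))
    (hexact_p : ∀ n s : ℤ, LinearMap.range (f n (s - 1) s) = LinearMap.ker (p n s))
    (hexact_bd : ∀ n s : ℤ, LinearMap.range (p n s) = LinearMap.ker (bd n s))
    (hexact_i : ∀ n s : ℤ, LinearMap.range (bd n s) = LinearMap.ker (f (n - 1) (s - 1) s))
    (r : ℕ) (n s : ℤ) (hs : 0 ≤ s) (hr : max s ((N : ℤ) - s + 1) ≤ (r : ℤ)) :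
    ((bPers f n s (s + (r : ℤ) - 1) : ℤ) - (bPers f n (s - 1) (s + (r : ℤ) - 1) : ℤ)) +
        ((bPers f (n - 1) (s - (r : ℤ)) (s - 1) : ℤ) - (bPers f (n - 1) (s - (r : ℤ)) s : ℤ)) =
      (bPers f n s (N : ℤ) : ℤ) - (bPers f n (s - 1) (N : ℤ) : ℤ) ∧
    (bPers f n s (N : ℤ) : ℤ) - (bPers f n (s - 1) (N : ℤ) : ℤ) =
      (Module.finrank k (GrH N f n s) : ℤ) := by
  have hr1 : s ≤ (r : ℤ) := le_trans (le_max_left _ _) hr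
  have hr2 : (N : ℤ) - s + 1 ≤ (r : ℤ) := le_trans (le_max_right _ _) hr
  have key : ∀ (m a t : ℤ), (N : ℤ) ≤ t → bPers f m a t = bPers f m a (N : ℤ) := by
    intro m a t ht
    unfold bPers persH
    rcases le_total a (N : ℤ) with ha | ha
    · rw [← hf_comp m a N t ha ht, LinearMap.range_comp]
      exact (Submodule.equivMapOfInjective _ (hstable m N t le_rfl ht).1 _).finrank_eq.symm
    · rw [LinearMap.finrank_range_of_inj (hstable m a t ha ht).1,
        LinearMap.finrank_range_of_inj (hstable m a N ha le_rfl).1]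
  have zero : ∀ (m a t : ℤ), a ≤ 0 → bPers f m a t = 0 := by
    intro m a t ha
    have := hzeroH m a ha
    have h0 : f m a t = 0 := LinearMap.ext fun x => by
      rw [Subsingleton.elim x 0]; simp
    unfold bPers persH
    rw [h0, LinearMap.range_zero, finrank_bot]
  have hle : persH f n (s - 1) (N : ℤ) ≤ persH f n s (N : ℤ) := by
    rcases le_total s (N : ℤ) with h | h
    · unfold persH
      rw [← hf_comp n (s - 1) s N (by omega) h]
      exact LinearMap.range_comp_le_range _ _
    · unfold persH
      rw [LinearMap.range_eq_top.mpr (hstable n s N h le_rfl).2]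
      exact le_top
  constructor
  · rw [key n s _ (by omega), key n (s - 1) _ (by omega), zero _ _ (s - 1) (by omega),
      zero _ _ s (by omega)]
    simp
  · have h1 := Submodule.finrank_quotient_add_finrank
      (Submodule.comap (persH f n s (N : ℤ)).subtype (persH f n (s - 1) (N : ℤ)))
    have h2 := (Submodule.comapSubtypeEquivOfLe hle).finrank_eq
    rw [h2] at h1
    have h3 : Module.finrank k (GrH N f n s) + bPers f n (s - 1) (N : ℤ)
        = bPers f n s (N : ℤ) := h1
    omega
end
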